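/- Let x = (x_n) be a real sequence. Then the set {ω ∈ (0,1] : Λ_x = Λ_{x↾ω}} has Lebesgue measure 1, i.e., λ({ω ∈ (0,1] : Λ_x = Λ_{x↾ω}}) = 1, where λ is the Lebesgue measure on ℝ. -/

import Mathlib

open Filter Set Topology
open scoped Classical

/-- Upper asymptotic density `d*(X) = limsup_{n→∞} |X ∩ [1,n]| / n`. -/
noncomputable def upperDensity (X : Set ℕ) : ℝ :=
  Filter.limsup
    (fun n : ℕ => (((Finset.Icc 1 n).filter (fun i => i ∈ X)).card : ℝ) / n)
    Filter.atTop

/-- `ℓ` is an ordinary limit point of `x`: some subsequence converges to `ℓ`. -/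
def IsLimitPt (x : ℕ → ℝ) (ℓ : ℝ) : Prop :=
  ∃ φ : ℕ → ℕ, StrictMono φ ∧
    Filter.Tendsto (fun k => x (φ k)) Filter.atTop (nhds ℓ)

/-- `L_x`, the set of ordinary limit points of `x`. -/
def limitPts (x : ℕ → ℝ) : Set ℝ := {ℓ | IsLimitPt x ℓ}

/-- `ℓ` is a statistical cluster point of `x`. -/
def IsStatClusterPt (x : ℕ → ℝ) (ℓ : ℝ) : Prop :=
  ∀ ε : ℝ, 0 < ε → 0 < upperDensity {n : ℕ | |x n - ℓ| ≤ ε}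

/-- `Γ_x`, the set of statistical cluster points of `x`. -/
def statClusterPts (x : ℕ → ℝ) : Set ℝ := {ℓ | IsStatClusterPt x ℓ}

/-- `ℓ` is a statistical limit point of `x`: some subsequence along an index set
of positive upper density converges to `ℓ`. -/
def IsStatLimitPt (x : ℕ → ℝ) (ℓ : ℝ) : Prop :=
  ∃ φ : ℕ → ℕ, StrictMono φ ∧
    Filter.Tendsto (fun k => x (φ k)) Filter.atTop (nhds ℓ) ∧
    0 < upperDensity (Set.range φ)

/-- `Λ_x`, the set of statistical limit points of `x`. -/
def statLimitPts (x : ℕ → ℝ) : Set ℝ := {ℓ | IsStatLimitPt x ℓ}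

/-- The `n`-th binary digit (`n ≥ 1`) of `ω ∈ (0,1]` in the unique binary
representation of `ω` having infinitely many digits equal to `1`:
the partial sums of that representation are `s_N = (⌈2^N ω⌉ - 1)/2^N`. -/
noncomputable def binDigit (ω : ℝ) (n : ℕ) : ℤ :=
  ⌈(2 : ℝ) ^ n * ω⌉ - 2 * ⌈(2 : ℝ) ^ (n - 1) * ω⌉ + 1

/-- The set of indices `n ≥ 1` with `d_n(ω) = 1`. -/
def digitOneSet (ω : ℝ) : Set ℕ := {n | 1 ≤ n ∧ binDigit ω n = 1}

/-- The subsequence `x↾ω` of `x` obtained by choosing, in increasing order,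
all indices `n` with `d_n(ω) = 1`. -/
noncomputable def subseq (x : ℕ → ℝ) (ω : ℝ) : ℕ → ℝ :=
  fun k => x (Nat.nth (fun n => n ∈ digitOneSet ω) k)

/-- `q_{ω,m}(N)`: the proportion, among the first `N` terms of `x↾ω`,
of those within `1/m` of `ℓ`. -/
noncomputable def qdens (x : ℕ → ℝ) (ℓ : ℝ) (ω : ℝ) (m N : ℕ) : ℝ :=
  (((Finset.range N).filter (fun i => |subseq x ω i - ℓ| ≤ 1 / m)).card : ℝ) / N


/-- The elements of `X` in `[1, n]`. -/
noncomputable def initSeg (X : Set ℕ) (n : ℕ) : Finset ℕ :=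
  (Finset.Icc 1 n).filter (fun i => i ∈ X)

/-- The number of elements of `X` in `[1, n]`. -/
noncomputable def initCount (X : Set ℕ) (n : ℕ) : ℕ :=
  (initSeg X n).card

lemma mem_initSeg {X : Set ℕ} {n m : ℕ} : m ∈ initSeg X n ↔ (1 ≤ m ∧ m ≤ n) ∧ m ∈ X := by
  simp [initSeg]

/-- `X` occupies a proportion greater than `r` of infinitely many initial segments. -/
def FreqDense (X : Set ℕ) (r : ℝ) : Prop :=
  ∃ᶠ n : ℕ in atTop, r * n < initCount X n

lemma initCount_le (X : Set ℕ) (n : ℕ) : initCount X n ≤ n := by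
  simpa [initCount, initSeg] using Finset.card_filter_le (Finset.Icc 1 n) (fun i => i ∈ X)

lemma initCount_mono {X Y : Set ℕ} (h : X ⊆ Y) (n : ℕ) : initCount X n ≤ initCount Y n :=
  Finset.card_le_card (Finset.monotone_filter_right _ (fun _ _ hi => h hi))

lemma FreqDense.mono {X Y : Set ℕ} {r : ℝ} (hX : FreqDense X r) (h : X ⊆ Y) : FreqDense Y r :=
  Frequently.mono hX fun n hn => hn.trans_le (by exact_mod_cast initCount_mono h n)

lemma initCount_le_add_of_forall_lt {X Y : Set ℕ} {M : ℕ} (n : ℕ)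
    (h : ∀ m ∈ X, M < m → m ≤ n → m ∈ Y) : initCount X n ≤ M + initCount Y n := by
  have hsub : initSeg X n ⊆ Finset.Icc 1 M ∪ initSeg Y n := by
    intro m hm
    simp only [Finset.mem_union, mem_initSeg, Finset.mem_Icc] at hm ⊢
    by_cases hM : m ≤ M
    · exact Or.inl ⟨hm.1.1, hM⟩
    · exact Or.inr ⟨hm.1, h m hm.2 (by omega) hm.1.2⟩
  refine (Finset.card_le_card hsub).trans ((Finset.card_union_le _ _).trans ?_)
  simp [initCount, initSeg]

lemma FreqDense.half_of_forall_lt {X Y : Set ℕ} {r : ℝ} (hr : 0 < r) (hX : FreqDense X r)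
    {M : ℕ} (h : ∀ m ∈ X, M < m → m ∈ Y) : FreqDense Y (r / 2) := by
  have hlarge : ∀ᶠ n : ℕ in atTop, (M : ℝ) / (r / 2) ≤ n :=
    tendsto_natCast_atTop_atTop.eventually_ge_atTop _
  refine (Frequently.and_eventually hX hlarge).mono ?_
  rintro n ⟨hn, hM⟩
  rw [div_le_iff₀ (by positivity)] at hM
  have h1 : (initCount X n : ℝ) ≤ M + initCount Y n := by
    exact_mod_cast initCount_le_add_of_forall_lt n fun m hm hMm _ => h m hm hMm
  linarith

lemma FreqDense.infinite {X : Set ℕ} {r : ℝ} (hr : 0 < r) (hX : FreqDense X r) :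
    X.Infinite := by
  intro hfin
  obtain ⟨M, hM⟩ := hfin.bddAbove
  have hempty : FreqDense ∅ (r / 2) :=
    hX.half_of_forall_lt hr (M := M) fun m hm hlt => absurd (hM hm) (by omega)
  obtain ⟨n, hn⟩ := hempty.exists
  have : (initCount ∅ n : ℝ) = 0 := by simp [initCount, initSeg]
  have : (0 : ℝ) ≤ r / 2 * n := by positivity
  linarith

lemma upperDensity_pos_iff {X : Set ℕ} : 0 < upperDensity X ↔ ∃ r > 0, FreqDense X r := by
  have hnonneg : ∀ n : ℕ, (0 : ℝ) ≤ (initCount X n : ℝ) / n := fun n => by positivity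
  have hle : ∀ n : ℕ, (initCount X n : ℝ) / n ≤ 1 := fun n =>
    div_le_one_of_le₀ (by exact_mod_cast initCount_le X n) (Nat.cast_nonneg n)
  constructor
  · intro h
    refine ⟨upperDensity X / 2, by positivity, ?_⟩
    have hlt : upperDensity X / 2 < limsup (fun n : ℕ => (initCount X n : ℝ) / n) atTop :=
      half_lt_self h
    have hfreq := frequently_lt_of_lt_limsup
      (isCoboundedUnder_le_of_le atTop (x := 0) hnonneg) hlt
    refine (hfreq.and_eventually (eventually_gt_atTop 0)).mono ?_
    rintro n ⟨hn, hpos⟩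
    rwa [lt_div_iff₀ (by exact_mod_cast hpos)] at hn
  · rintro ⟨r, hr, hX⟩
    refine hr.trans_le (le_limsup_of_frequently_le ?_ (isBoundedUnder_of ⟨1, hle⟩))
    refine (Frequently.and_eventually hX (eventually_gt_atTop 0)).mono ?_
    rintro n ⟨hn, hpos⟩
    rw [le_div_iff₀ (by exact_mod_cast hpos)]
    exact hn.le

/-- A decreasing sequence of sets which are uniformly frequently dense has a frequently dense
pseudo-intersection. -/
lemma exists_freqDense_pseudoIntersection {A : ℕ → Set ℕ} (hA : Antitone A) {r : ℝ} (hr : 0 < r)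
    (h : ∀ k, FreqDense (A k) r) :
    ∃ S, FreqDense S (r / 2) ∧ ∀ k, ∃ M, ∀ m ∈ S, M < m → m ∈ A k := by
  have hstep : ∀ k M : ℕ, ∃ n, M < n ∧ (M : ℝ) ≤ r / 2 * n ∧ r * n < initCount (A k) n := by
    intro k M
    have hlarge : ∀ᶠ n : ℕ in atTop, (M : ℝ) / (r / 2) ≤ n :=
      tendsto_natCast_atTop_atTop.eventually_ge_atTop _
    obtain ⟨n, hn, hM, hlt⟩ :=
      ((h k).and_eventually (hlarge.and (eventually_gt_atTop M))).exists
    rw [div_le_iff₀ (by positivity)] at hM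
    exact ⟨n, hlt, by linarith, hn⟩
  choose f hlt hle hdense using hstep
  obtain ⟨N, hN⟩ : ∃ N : ℕ → ℕ, ∀ k, N (k + 1) = f k (N k) :=
    ⟨fun k => Nat.rec 0 f k, fun _ => rfl⟩
  have hmono : StrictMono N := strictMono_nat_of_lt_succ fun k => by rw [hN]; exact hlt _ _
  refine ⟨{n | ∀ k, N k < n → n ∈ A k}, ?_, fun k => ⟨N k, fun m hm => hm k⟩⟩
  refine frequently_atTop.2 fun a => ⟨N (a + 1), ?_, ?_⟩
  · exact (Nat.le_succ a).trans (hmono.id_le (a + 1))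
  · have hcount : (initCount (A a) (N (a + 1)) : ℝ) ≤
        (N a : ℝ) + initCount {n | ∀ k, N k < n → n ∈ A k} (N (a + 1)) := by
      norm_cast
      refine initCount_le_add_of_forall_lt _ fun m hm _ hle k hk => ?_
      have : k < a + 1 := hmono.lt_iff_lt.1 (hk.trans_le hle)
      exact hA (by omega) hm
    have h1 := hle a (N a)
    have h2 := hdense a (N a)
    rw [← hN] at h1 h2
    linarith

lemma mem_statLimitPts_iff {x : ℕ → ℝ} {ℓ : ℝ} :
    ℓ ∈ statLimitPts x ↔ ∃ r > 0, ∀ ε > 0, FreqDense {n | |x n - ℓ| < ε} r := by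
  constructor
  · rintro ⟨φ, hφ, hlim, hpos⟩
    obtain ⟨r, hr, hdense⟩ := upperDensity_pos_iff.1 hpos
    refine ⟨r / 2, by positivity, fun ε hε => ?_⟩
    obtain ⟨K, hK⟩ := Metric.tendsto_atTop.1 hlim ε hε
    refine hdense.half_of_forall_lt hr (M := φ K) ?_
    rintro _ ⟨k, rfl⟩ hk
    exact hK k (hφ.lt_iff_lt.1 hk).le
  · rintro ⟨r, hr, h⟩
    have hanti : Antitone fun k : ℕ => {n | |x n - ℓ| < 1 / ((k : ℝ) + 1)} :=
      fun i j hij n (hn : |x n - ℓ| < _) => lt_of_lt_of_le hn (Nat.one_div_le_one_div hij)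
    obtain ⟨S, hS, hSA⟩ := exists_freqDense_pseudoIntersection hanti hr
      fun k => h _ Nat.one_div_pos_of_nat
    have hinf : S.Infinite := hS.infinite (by positivity)
    have hmono : StrictMono (Nat.nth (fun n => n ∈ S)) := Nat.nth_strictMono hinf
    refine ⟨Nat.nth (fun n => n ∈ S), hmono, ?_, ?_⟩
    · refine Metric.tendsto_atTop.2 fun ε hε => ?_
      obtain ⟨k, hk⟩ := exists_nat_one_div_lt hε
      obtain ⟨M, hM⟩ := hSA k
      refine ⟨M + 1, fun n hn => lt_trans (hM _ (Nat.nth_mem_of_infinite hinf n) ?_) hk⟩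
      exact lt_of_lt_of_le hn (hmono.id_le n)
    · refine upperDensity_pos_iff.2 ⟨r / 2, by positivity, ?_⟩
      rw [Nat.range_nth_of_infinite (p := fun n => n ∈ S) hinf]
      exact hS

section Subsequence

variable {K : Set ℕ}

lemma tendsto_initCount_atTop {c : ℝ} (hc : 0 < c)
    (h : ∀ᶠ n : ℕ in atTop, c * n ≤ initCount K n) :
    Tendsto (initCount K) atTop atTop := by
  refine (tendsto_natCast_atTop_iff (R := ℝ)).1 ?_
  exact tendsto_atTop_mono' _ h (tendsto_natCast_atTop_atTop.const_mul_atTop hc)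

lemma initCount_inter_le (hK : 0 ∉ K) (A : Set ℕ) (n : ℕ) :
    initCount (A ∩ K) n ≤ initCount {k | Nat.nth (fun m => m ∈ K) k ∈ A} (initCount K n) + 1 := by
  set B : Set ℕ := {k | Nat.nth (fun m => m ∈ K) k ∈ A}
  have hsub : initSeg (A ∩ K) n ⊆ (insert 0 (initSeg B (initCount K n))).image
        (Nat.nth (fun m => m ∈ K)) := by
    intro m hm
    obtain ⟨⟨_, hmn⟩, hmA, hmK⟩ := mem_initSeg.1 hm
    have hnth : Nat.nth (fun m => m ∈ K) (Nat.count (fun m => m ∈ K) m) = m :=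
      Nat.nth_count (p := fun m => m ∈ K) hmK
    refine Finset.mem_image.2 ⟨Nat.count (fun m => m ∈ K) m, ?_, hnth⟩
    rcases Nat.eq_zero_or_pos (Nat.count (fun m => m ∈ K) m) with h0 | h0
    · simp [h0]
    · refine Finset.mem_insert_of_mem (mem_initSeg.2 ⟨⟨h0, ?_⟩, ?_⟩)
      · rw [Nat.count_eq_card_filter_range]
        refine Finset.card_le_card fun i hi => ?_
        simp only [Finset.mem_filter, Finset.mem_range, mem_initSeg] at hi ⊢
        have : i ≠ 0 := fun h => hK (h ▸ hi.2)
        exact ⟨by omega, hi.2⟩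
      · simpa [B, hnth] using hmA
  exact (Finset.card_le_card hsub).trans
    (Finset.card_image_le.trans (Finset.card_insert_le _ _))

lemma initCount_preimage_nth_le (hK : 0 ∉ K) (hinf : K.Infinite) (A : Set ℕ) (N : ℕ) :
    initCount {k | Nat.nth (fun m => m ∈ K) k ∈ A} N ≤
      initCount A (Nat.nth (fun m => m ∈ K) N) := by
  refine Finset.card_le_card_of_injOn (Nat.nth (fun m => m ∈ K)) ?_
    (Nat.nth_injective hinf).injOn
  intro k hk
  simp only [Finset.mem_coe, mem_initSeg] at hk ⊢
  refine ⟨⟨?_, Nat.nth_monotone hinf hk.1.2⟩, hk.2⟩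
  refine Nat.one_le_iff_ne_zero.2 fun h => hK ?_
  rw [← h]
  exact Nat.nth_mem_of_infinite hinf k

lemma initCount_nth_le (hinf : K.Infinite) (N : ℕ) :
    initCount K (Nat.nth (fun m => m ∈ K) N) ≤ N + 1 := by
  have hcount := Nat.count_nth_succ_of_infinite (p := fun m => m ∈ K) hinf N
  rw [Nat.count_eq_card_filter_range] at hcount
  rw [← hcount]
  refine Finset.card_le_card fun i hi => ?_
  simp only [Finset.mem_filter, Finset.mem_range, mem_initSeg] at hi ⊢
  exact ⟨by omega, hi.2⟩

lemma FreqDense.of_preimage_nth (hK : 0 ∉ K) {c : ℝ} (hc : 0 < c)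
    (h : ∀ᶠ n : ℕ in atTop, c * n ≤ initCount K n) {A : Set ℕ} {r : ℝ} (hr : 0 < r)
    (hA : FreqDense {k | Nat.nth (fun m => m ∈ K) k ∈ A} r) :
    FreqDense A (r * c / 2) := by
  have hinf : K.Infinite := by
    refine FreqDense.infinite (half_pos hc) ((h.and (eventually_gt_atTop 0)).frequently.mono ?_)
    rintro n ⟨hn, hpos⟩
    have : (0 : ℝ) < n := by exact_mod_cast hpos
    nlinarith
  have hmono : StrictMono (Nat.nth (fun m => m ∈ K)) := Nat.nth_strictMono hinf
  refine hmono.tendsto_atTop.frequently (f := Nat.nth (fun m => m ∈ K)) ?_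
  refine (Frequently.and_eventually hA
    ((hmono.tendsto_atTop.eventually h).and (eventually_ge_atTop 1))).mono ?_
  rintro N ⟨hN, hcN, h1⟩
  have h2 : (initCount {k | Nat.nth (fun m => m ∈ K) k ∈ A} N : ℝ) ≤
    initCount A (Nat.nth (fun m => m ∈ K) N) := by
      exact_mod_cast initCount_preimage_nth_le hK hinf A N
  have h3 : (initCount K (Nat.nth (fun m => m ∈ K) N) : ℝ) ≤ N + 1 := by
    exact_mod_cast initCount_nth_le hinf N
  have h4 : (1 : ℝ) ≤ N := by exact_mod_cast h1
  nlinarith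

lemma FreqDense.preimage_nth (hK : 0 ∉ K) (htop : Tendsto (initCount K) atTop atTop)
    {A : Set ℕ} {r : ℝ} (hr : 0 < r) (hA : FreqDense A r)
    (h : Tendsto (fun n : ℕ => ((initCount (A ∩ K) n : ℝ) - initCount A n / 2) / n) atTop (𝓝 0)) :
    FreqDense {k | Nat.nth (fun m => m ∈ K) k ∈ A} (r / 8) := by
  refine htop.frequently (f := initCount K) ?_
  have hsmall : ∀ᶠ n : ℕ in atTop,
      -(r / 4) < ((initCount (A ∩ K) n : ℝ) - initCount A n / 2) / n :=
    h.eventually_const_lt (by linarith)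
  have hlarge : ∀ᶠ n : ℕ in atTop, 1 / (r / 8) < (n : ℝ) :=
    tendsto_natCast_atTop_atTop.eventually_gt_atTop _
  refine (Frequently.and_eventually hA
    (hsmall.and (hlarge.and (eventually_gt_atTop 0)))).mono ?_
  rintro n ⟨hn, hs, hl, hpos⟩
  rw [lt_div_iff₀ (by exact_mod_cast hpos)] at hs
  rw [div_lt_iff₀ (by positivity)] at hl
  have h1 : (initCount (A ∩ K) n : ℝ) ≤
      initCount {k | Nat.nth (fun m => m ∈ K) k ∈ A} (initCount K n) + 1 := by
    exact_mod_cast initCount_inter_le hK A n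
  have h2 : (initCount K n : ℝ) ≤ n := by exact_mod_cast initCount_le K n
  nlinarith

end Subsequence

lemma ceil_eq_ceil_two_mul_add_one_ediv (y : ℝ) : ⌈y⌉ = (⌈2 * y⌉ + 1) / 2 := by
  have h1 := Int.ceil_lt_add_one (2 * y)
  have h2 := Int.le_ceil (2 * y)
  set c := ⌈2 * y⌉
  obtain ⟨h3, h4⟩ : 2 * ((c + 1) / 2) ≤ c + 1 ∧ c ≤ 2 * ((c + 1) / 2) := by omega
  have h5 : (2 * ((c + 1) / 2 : ℤ) : ℝ) ≤ c + 1 := by exact_mod_cast h3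
  have h6 : (c : ℝ) ≤ 2 * ((c + 1) / 2 : ℤ) := by exact_mod_cast h4
  rw [Int.ceil_eq_iff]
  constructor <;> linarith

lemma ceil_two_pow_mul (n : ℕ) (ω : ℝ) :
    ⌈(2 : ℝ) ^ n * ω⌉ = (⌈(2 : ℝ) ^ (n + 1) * ω⌉ + 1) / 2 := by
  rw [ceil_eq_ceil_two_mul_add_one_ediv, pow_succ']
  ring_nf

lemma ceil_two_pow_mul_congr {ω ω' : ℝ} {i j : ℕ} (hij : i ≤ j)
    (h : ⌈(2 : ℝ) ^ j * ω⌉ = ⌈(2 : ℝ) ^ j * ω'⌉) :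
    ⌈(2 : ℝ) ^ i * ω⌉ = ⌈(2 : ℝ) ^ i * ω'⌉ := by
  induction j, hij using Nat.le_induction with
  | base => exact h
  | succ j _ ih => exact ih (by rw [ceil_two_pow_mul, h, ← ceil_two_pow_mul])

lemma ceil_two_pow_mul_add (n : ℕ) (ω : ℝ) :
    ⌈(2 : ℝ) ^ n * (ω + (2 ^ n)⁻¹)⌉ = ⌈(2 : ℝ) ^ n * ω⌉ + 1 := by
  rw [mul_add, mul_inv_cancel₀ (by positivity), Int.ceil_add_one]

/-- The reals `ω` such that `⌈2 ^ n * ω⌉` is even; for `n ≥ 1`, those whose `n`-th binary digit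
is one. -/
def evenCeilSet (n : ℕ) : Set ℝ := {ω | Even ⌈(2 : ℝ) ^ n * ω⌉}

lemma measurableSet_evenCeilSet (n : ℕ) : MeasurableSet (evenCeilSet n) := by
  have h : Measurable fun ω : ℝ => ⌈(2 : ℝ) ^ n * ω⌉ :=
    Int.measurable_ceil.comp (measurable_const_mul _)
  exact h (MeasurableSet.of_discrete (s := {c : ℤ | Even c}))

lemma succ_mem_digitOneSet_iff {ω : ℝ} {n : ℕ} :
    n + 1 ∈ digitOneSet ω ↔ ω ∈ evenCeilSet (n + 1) := by
  have h := ceil_two_pow_mul n ω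
  simp only [digitOneSet, binDigit, evenCeilSet, Set.mem_ofPred_eq, Nat.add_sub_cancel,
    Int.even_iff]
  omega

lemma mem_Ioc_iff_ceil (n : ℕ) (ω : ℝ) :
    ω ∈ Ioc (0 : ℝ) 1 ↔ 0 < ⌈(2 : ℝ) ^ n * ω⌉ ∧ ⌈(2 : ℝ) ^ n * ω⌉ ≤ 2 ^ n := by
  have h2 : (0 : ℝ) < 2 ^ n := by positivity
  rw [Int.ceil_pos, Int.ceil_le, mem_Ioc]
  push_cast
  rw [mul_pos_iff_of_pos_left h2, mul_le_iff_le_one_right h2]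

open MeasureTheory ProbabilityTheory

/-- Lebesgue measure on `(0, 1]`. -/
noncomputable abbrev volumeIoc : Measure ℝ := volume.restrict (Ioc 0 1)

instance : IsProbabilityMeasure volumeIoc := ⟨by simp⟩

/-- A set which is invariant under flipping the `(n+1)`-st digit is halved by that digit. -/
lemma measureReal_inter_evenCeilSet {P : Set ℝ} {n : ℕ}
    (hP : ∀ ω : ℝ, ω ∉ evenCeilSet (n + 1) → (ω + (2 ^ (n + 1))⁻¹ ∈ P ↔ ω ∈ P)) :
    volumeIoc.real (P ∩ evenCeilSet (n + 1)) = volumeIoc.real P / 2 := by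
  have hE := measurableSet_evenCeilSet (n + 1)
  have hpre : (fun ω : ℝ => ω + (2 ^ (n + 1))⁻¹) ⁻¹' (P ∩ evenCeilSet (n + 1) ∩ Ioc 0 1) =
      P \ evenCeilSet (n + 1) ∩ Ioc 0 1 := by
    ext ω
    have hpow : (2 : ℤ) ^ (n + 1) = 2 * 2 ^ n := pow_succ' _ _
    have hiff : (ω + (2 ^ (n + 1))⁻¹ ∈ evenCeilSet (n + 1) ∧ ω + (2 ^ (n + 1))⁻¹ ∈ Ioc (0 : ℝ) 1) ↔
        (ω ∉ evenCeilSet (n + 1) ∧ ω ∈ Ioc (0 : ℝ) 1) := by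
      rw [mem_Ioc_iff_ceil (n + 1), mem_Ioc_iff_ceil (n + 1) ω]
      simp only [evenCeilSet, Set.mem_ofPred_eq, ceil_two_pow_mul_add, Int.even_iff]
      omega
    have := hP ω
    simp only [mem_preimage, mem_inter_iff, Set.mem_sdiff]
    tauto
  have heq : volumeIoc.real (P ∩ evenCeilSet (n + 1)) = volumeIoc.real (P \ evenCeilSet (n + 1)) := by
    simp only [Measure.real, Measure.restrict_apply' measurableSet_Ioc]
    rw [← hpre, measure_preimage_add_right]
  have hadd := measureReal_inter_add_sdiff (μ := volumeIoc) (s := P) hE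
  linarith

lemma measureReal_evenCeilSet (n : ℕ) : volumeIoc.real (evenCeilSet (n + 1)) = 1 / 2 := by
  have h := measureReal_inter_evenCeilSet (P := univ) (n := n) (by simp)
  rwa [univ_inter, probReal_univ] at h

lemma indepSet_evenCeilSet {i j : ℕ} (hij : i ≠ j) :
    IndepSet (evenCeilSet (i + 1)) (evenCeilSet (j + 1)) volumeIoc := by
  wlog hlt : i < j generalizing i j
  · exact (this hij.symm (by omega)).symm
  rw [indepSet_iff_measure_inter_eq_mul (measurableSet_evenCeilSet _)
    (measurableSet_evenCeilSet _) volumeIoc, ← ENNReal.toReal_eq_toReal_iff' (by finiteness) (by finiteness),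
    ENNReal.toReal_mul]
  change volumeIoc.real _ = volumeIoc.real _ * volumeIoc.real _
  rw [measureReal_inter_evenCeilSet, measureReal_evenCeilSet, measureReal_evenCeilSet]
  · norm_num
  · intro ω hω
    have hlevel : ⌈(2 : ℝ) ^ j * (ω + (2 ^ (j + 1))⁻¹)⌉ = ⌈(2 : ℝ) ^ j * ω⌉ := by
      rw [ceil_two_pow_mul, ceil_two_pow_mul j ω, ceil_two_pow_mul_add]
      simp only [evenCeilSet, Set.mem_ofPred_eq, Int.even_iff] at hω
      omega
    simp only [evenCeilSet, Set.mem_ofPred_eq, ceil_two_pow_mul_congr hlt hlevel]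

lemma identDistrib_indicator_one {Ω : Type*} [MeasurableSpace Ω] {μ : Measure Ω}
    [IsProbabilityMeasure μ] {s t : Set Ω} (hs : MeasurableSet s) (ht : MeasurableSet t)
    (h : μ s = μ t) :
    IdentDistrib (s.indicator (fun _ => (1 : ℝ))) (t.indicator (fun _ => (1 : ℝ))) μ μ := by
  have hs' : Measurable (s.indicator fun _ => (1 : ℝ)) := measurable_const.indicator hs
  have ht' : Measurable (t.indicator fun _ => (1 : ℝ)) := measurable_const.indicator ht
  refine ⟨hs'.aemeasurable, ht'.aemeasurable, Measure.ext fun S hS => ?_⟩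
  rw [Measure.map_apply hs' hS, Measure.map_apply ht' hS, indicator_const_preimage_eq_union,
    indicator_const_preimage_eq_union]
  split_ifs <;> simp [prob_compl_eq_one_sub, hs, ht, h]

/-- The strong law of large numbers for binary digits compared with a fixed pattern `A`. -/
lemma ae_tendsto_average_indicator (A : Set ℕ) :
    ∀ᵐ ω ∂volumeIoc, Tendsto (fun n : ℕ => (∑ i ∈ Finset.range n,
      (if i + 1 ∈ A then evenCeilSet (i + 1) else (evenCeilSet (i + 1))ᶜ).indicator
        (fun _ => (1 : ℝ)) ω) / n) atTop (𝓝 (1 / 2)) := by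
  let B : ℕ → Set ℝ := fun i =>
    if i + 1 ∈ A then evenCeilSet (i + 1) else (evenCeilSet (i + 1))ᶜ
  have hgen : ∀ i, MeasurableSet[MeasurableSpace.generateFrom {evenCeilSet (i + 1)}] (B i) := by
    intro i
    have h : MeasurableSet[MeasurableSpace.generateFrom {evenCeilSet (i + 1)}]
      (evenCeilSet (i + 1)) := MeasurableSpace.measurableSet_generateFrom rfl
    by_cases hi : i + 1 ∈ A
    · simpa only [B, if_pos hi] using h
    · simpa only [B, if_neg hi] using h.compl
  have hB : ∀ i, MeasurableSet (B i) := fun i => by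
    refine MeasurableSpace.generateFrom_le ?_ _ (hgen i)
    rintro _ rfl
    exact measurableSet_evenCeilSet _
  have hBhalf : ∀ i, volumeIoc.real (B i) = 1 / 2 := fun i => by
    by_cases hi : i + 1 ∈ A
    · simp only [B, if_pos hi, measureReal_evenCeilSet]
    · simp only [B, if_neg hi, probReal_compl_eq_one_sub (measurableSet_evenCeilSet _),
        measureReal_evenCeilSet]
      norm_num
  have hslln := strong_law_ae_real (μ := volumeIoc) (fun i => (B i).indicator fun _ => (1 : ℝ))
    ((integrable_const (1 : ℝ)).indicator (hB 0)) ?_ ?_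
  · rw [integral_indicator_const _ (hB 0), hBhalf] at hslln
    simpa using hslln
  · intro i j hij
    have hle : ∀ i, MeasurableSpace.comap ((B i).indicator fun _ => (1 : ℝ)) inferInstance ≤
        MeasurableSpace.generateFrom {evenCeilSet (i + 1)} := fun i =>
      Measurable.comap_le (Measurable.indicator measurable_const (hgen i))
    exact (IndepFun_iff_Indep _ _ _).2 (indep_of_indep_of_le_left
      (indep_of_indep_of_le_right (indepSet_evenCeilSet hij) (hle j)) (hle i))
  · intro i
    refine identDistrib_indicator_one (hB i) (hB 0) ?_
    rw [← measureReal_eq_measureReal_iff, hBhalf, hBhalf]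

lemma initCount_eq_sum (X : Set ℕ) (n : ℕ) :
    (initCount X n : ℝ) = ∑ i ∈ Finset.range n, X.indicator (fun _ => (1 : ℝ)) (i + 1) := by
  rw [initCount, initSeg, Finset.card_filter, Finset.range_eq_Ico, Finset.sum_Ico_add'
    (fun i => X.indicator (fun _ => (1 : ℝ)) i)]
  push_cast
  exact Finset.sum_congr (by ext; simp) fun i _ => by simp [indicator_apply]

lemma ae_tendsto_initCount_digitOneSet :
    ∀ᵐ ω ∂volumeIoc, Tendsto (fun n : ℕ => (initCount (digitOneSet ω) n : ℝ) / n) atTop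
      (𝓝 (1 / 2)) := by
  filter_upwards [ae_tendsto_average_indicator univ] with ω hω
  refine hω.congr fun n => ?_
  rw [initCount_eq_sum]
  congr 1
  refine Finset.sum_congr rfl fun i _ => ?_
  simp [indicator_apply, succ_mem_digitOneSet_iff]

lemma ae_tendsto_initCount_inter_digitOneSet (A : Set ℕ) :
    ∀ᵐ ω ∂volumeIoc, Tendsto (fun n : ℕ =>
      ((initCount (A ∩ digitOneSet ω) n : ℝ) - initCount A n / 2) / n) atTop (𝓝 0) := by
  filter_upwards [ae_tendsto_average_indicator A, ae_tendsto_initCount_digitOneSet] with ω hA hK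
  have hlim := ((hA.add hK).sub_const 1).div_const 2
  norm_num at hlim
  refine hlim.congr' ?_
  filter_upwards [eventually_gt_atTop 0] with n hn
  have hn' : (n : ℝ) ≠ 0 := by exact_mod_cast hn.ne'
  have hsum : ∑ i ∈ Finset.range n,
      (if i + 1 ∈ A then evenCeilSet (i + 1) else (evenCeilSet (i + 1))ᶜ).indicator
        (fun _ => (1 : ℝ)) ω + initCount (digitOneSet ω) n - n =
      2 * initCount (A ∩ digitOneSet ω) n - initCount A n := by
    have hcard : (n : ℝ) = ∑ i ∈ Finset.range n, (1 : ℝ) := by simp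
    rw [initCount_eq_sum, initCount_eq_sum, initCount_eq_sum]
    rw [hcard]
    rw [Finset.mul_sum, ← Finset.sum_add_distrib, ← Finset.sum_sub_distrib,
      ← Finset.sum_sub_distrib]
    refine Finset.sum_congr rfl fun i _ => ?_
    by_cases hi : i + 1 ∈ A <;> by_cases hd : ω ∈ evenCeilSet (i + 1) <;>
      norm_num [succ_mem_digitOneSet_iff, hi, hd]
  field_simp
  linarith

lemma statLimitPts_subseq_eq {x : ℕ → ℝ} {ω : ℝ}
    (hK : Tendsto (fun n : ℕ => (initCount (digitOneSet ω) n : ℝ) / n) atTop (𝓝 (1 / 2)))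
    (hA : ∀ p : ℚ × ℚ, Tendsto (fun n : ℕ =>
      ((initCount ({m | x m ∈ Ioo (p.1 : ℝ) p.2} ∩ digitOneSet ω) n : ℝ) -
        initCount {m | x m ∈ Ioo (p.1 : ℝ) p.2} n / 2) / n) atTop (𝓝 0)) :
    statLimitPts x = statLimitPts (subseq x ω) := by
  have h0 : 0 ∉ digitOneSet ω := fun h => absurd h.1 (by norm_num)
  have hquarter : ∀ᶠ n : ℕ in atTop, 1 / 4 * (n : ℝ) ≤ initCount (digitOneSet ω) n := by
    filter_upwards [hK.eventually_const_lt (u := 1 / 4) (by norm_num), eventually_gt_atTop 0]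
      with n hn hpos
    exact ((lt_div_iff₀ (by exact_mod_cast hpos)).1 hn).le
  ext ℓ
  rw [mem_statLimitPts_iff, mem_statLimitPts_iff]
  constructor
  · rintro ⟨r, hr, h⟩
    refine ⟨r / 8, by positivity, fun ε hε => ?_⟩
    obtain ⟨a, ha, haℓ⟩ := exists_rat_btwn (sub_lt_self ℓ hε)
    obtain ⟨b, hbℓ, hb⟩ := exists_rat_btwn (lt_add_of_pos_right ℓ hε)
    have hdense : FreqDense {m | x m ∈ Ioo (a : ℝ) b} r := by
      refine (h (min (ℓ - a) (b - ℓ)) (lt_min (by linarith) (by linarith))).mono ?_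
      intro m (hm : |x m - ℓ| < _)
      obtain ⟨h1, h2⟩ := lt_min_iff.1 hm
      rw [abs_lt] at h1 h2
      exact ⟨by linarith, by linarith⟩
    refine (hdense.preimage_nth h0 (tendsto_initCount_atTop (by norm_num) hquarter) hr
      (hA (a, b))).mono fun k hk => ?_
    obtain ⟨h1, h2⟩ : (a : ℝ) < subseq x ω k ∧ subseq x ω k < b := hk
    change |subseq x ω k - ℓ| < ε
    exact abs_lt.2 ⟨by linarith, by linarith⟩
  · rintro ⟨r, hr, h⟩
    exact ⟨r * (1 / 4) / 2, by positivity, fun ε hε =>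
      FreqDense.of_preimage_nth h0 (by norm_num) hquarter hr (h ε hε)⟩

/-- `λ({ω ∈ (0,1] : Λ_x = Λ_{x↾ω}}) = 1`. -/
theorem stmt12 (x : ℕ → ℝ) :
    MeasureTheory.volume
        {ω : ℝ | ω ∈ Set.Ioc (0 : ℝ) 1 ∧ statLimitPts x = statLimitPts (subseq x ω)} =
      1 := by
  have hae : ∀ᵐ ω ∂volumeIoc, statLimitPts x = statLimitPts (subseq x ω) := by
    filter_upwards [ae_tendsto_initCount_digitOneSet, ae_all_iff.2 fun p : ℚ × ℚ =>
      ae_tendsto_initCount_inter_digitOneSet {m | x m ∈ Ioo (p.1 : ℝ) p.2}] with ω hK hA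
    exact statLimitPts_subseq_eq hK hA
  have hset : {ω : ℝ | ω ∈ Ioc (0 : ℝ) 1 ∧ statLimitPts x = statLimitPts (subseq x ω)} =
      {ω | statLimitPts x = statLimitPts (subseq x ω)} ∩ Ioc 0 1 := by
    ext ω
    exact and_comm
  rw [hset, ← Measure.restrict_apply' measurableSet_Ioc,
    measure_congr (eventuallyEq_univ.2 hae), measure_univ]
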